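/- arXiv:math/0608691 — 6 statements merged into one kernel-verified Lean document; each statement's English description precedes it below -/
import Mathlib

section
/- Let F be a field, n ≥ 1, and let A be the n×n matrix over F with entries A_{i,i+1} = α_i, A_{i+1,i} = β_i (1 ≤ i ≤ n−1), all other entries 0, where all α_i and β_i are nonzero. Then the linear system AX = 0 has a nontrivial solution X ∈ Fⁿ if and only if n is odd. -/
lemma tri_row {F : Type*} [Field F] (n : ℕ) (α β : ℕ → F)
    (A : Matrix (Fin n) (Fin n) F)
    (hA : ∀ i j : Fin n,
      A i j = if (j : ℕ) = (i : ℕ) + 1 then α ((i : ℕ) + 1)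
        else if (i : ℕ) = (j : ℕ) + 1 then β ((j : ℕ) + 1) else 0)
    (y : ℕ → F) (y0 : y 0 = 0) (yn : y (n + 1) = 0) (i : Fin n) :
    A.mulVec (fun j => y ((j : ℕ) + 1)) i
      = α ((i : ℕ) + 1) * y ((i : ℕ) + 2) + β (i : ℕ) * y (i : ℕ) := by
  have h1 : ∀ j : Fin n, A i j * y ((j : ℕ) + 1) =
      (if (j : ℕ) = (i : ℕ) + 1 then α ((i : ℕ) + 1) * y ((i : ℕ) + 2) else 0)
      + (if (j : ℕ) + 1 = (i : ℕ) then β (i : ℕ) * y (i : ℕ) else 0) := by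
    intro j
    rw [hA]
    by_cases h : (j : ℕ) = (i : ℕ) + 1
    · have h' : ¬ ((j : ℕ) + 1 = (i : ℕ)) := by omega
      rw [if_pos h, if_pos h, if_neg h', h, add_zero]
    · by_cases h' : (j : ℕ) + 1 = (i : ℕ)
      · rw [if_neg h, if_neg h, if_pos h'.symm, if_pos h', h', zero_add]
      · rw [if_neg h, if_neg h, if_neg (fun e => h' e.symm), if_neg h']; simp
  simp only [Matrix.mulVec, dotProduct, h1]
  rw [Finset.sum_add_distrib]
  congr 1
  · rw [Finset.sum_range (f := fun j => if j = (i : ℕ) + 1 then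
      α ((i : ℕ) + 1) * y ((i : ℕ) + 2) else 0) |>.symm, Finset.sum_ite_eq']
    split_ifs with h
    · rfl
    · have h2 : (i : ℕ) + 2 = n + 1 := by
        have := i.2
        simp only [Finset.mem_range] at h
        omega
      rw [h2, yn, mul_zero]
  · obtain ⟨k, hk⟩ := i
    cases k with
    | zero => simp [y0]
    | succ k =>
      simp only [Nat.add_right_cancel_iff]
      rw [Finset.sum_range (f := fun j => if j = k then
        β (k + 1) * y (k + 1) else 0) |>.symm, Finset.sum_ite_eq',
        if_pos (Finset.mem_range.2 (by omega))]

def triSol {F : Type*} [Field F] (α β : ℕ → F) : ℕ → F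
  | 0 => 0
  | 1 => 1
  | (i + 2) => -(β i * triSol α β i) / α (i + 1)

lemma triSol_even {F : Type*} [Field F] (α β : ℕ → F) (k : ℕ) :
    triSol α β (2 * k) = 0 := by
  induction k with
  | zero => simp [triSol]
  | succ k ih =>
    rw [show 2 * (k + 1) = 2 * k + 2 by ring, triSol, ih]; simp

/-- For a tridiagonal matrix over a field with zero diagonal and
nonzero super- and subdiagonal entries, the homogeneous system `A X = 0` has a
nontrivial solution iff the size `n` is odd. -/
theorem tridiagonal_kernel_nontrivial_iff_odd
    (F : Type*) [Field F] (n : ℕ) (hn1 : 1 ≤ n)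
    (α β : ℕ → F)
    (hα : ∀ i : ℕ, 1 ≤ i → i ≤ n - 1 → α i ≠ 0)
    (hβ : ∀ i : ℕ, 1 ≤ i → i ≤ n - 1 → β i ≠ 0)
    (A : Matrix (Fin n) (Fin n) F)
    (hA : ∀ i j : Fin n,
      A i j = if (j : ℕ) = (i : ℕ) + 1 then α ((i : ℕ) + 1)
        else if (i : ℕ) = (j : ℕ) + 1 then β ((j : ℕ) + 1) else 0) :
    (∃ X : Fin n → F, X ≠ 0 ∧ A.mulVec X = 0) ↔ Odd n := by
  constructor
  · rintro ⟨X, hX, hAX⟩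
    by_contra hodd
    apply hX
    rw [Nat.not_odd_iff_even] at hodd
    obtain ⟨m, hm⟩ := hodd
    let y : ℕ → F := fun k => if h : 1 ≤ k ∧ k ≤ n then X ⟨k - 1, by omega⟩ else 0
    have y0 : y 0 = 0 := by simp [y]
    have yn : y (n + 1) = 0 := by simp [y]
    have hXy : X = fun j : Fin n => y ((j : ℕ) + 1) := by
      funext j
      have h : 1 ≤ (j : ℕ) + 1 ∧ (j : ℕ) + 1 ≤ n := by have := j.2; omega
      simp only [y, dif_pos h]
      rfl
    have row : ∀ i, i < n → α (i + 1) * y (i + 2) + β i * y i = 0 := by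
      intro i hi
      have h := tri_row n α β A hA y y0 yn ⟨i, hi⟩
      rw [← hXy, hAX] at h
      exact h.symm
    have ev : ∀ k, 2 * k ≤ n → y (2 * k) = 0 := by
      intro k
      induction k with
      | zero => intro _; exact y0
      | succ k ih =>
        intro hk
        have h := row (2 * k) (by omega)
        rw [ih (by omega), mul_zero, add_zero] at h
        exact (mul_eq_zero.1 h).resolve_left (hα _ (by omega) (by omega))
    have od : ∀ k, 2 * k ≤ n → y (n + 1 - 2 * k) = 0 := by
      intro k
      induction k with
      | zero => intro _; exact yn
      | succ k ih =>
        intro hk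
        have h := row (n + 1 - 2 * (k + 1)) (by omega)
        rw [show n + 1 - 2 * (k + 1) + 2 = n + 1 - 2 * k by omega, ih (by omega),
          mul_zero, zero_add] at h
        exact (mul_eq_zero.1 h).resolve_left (hβ _ (by omega) (by omega))
    rw [hXy]
    funext j
    have hj := j.2
    show y ((j : ℕ) + 1) = 0
    rcases Nat.even_or_odd' ((j : ℕ) + 1) with ⟨c, hc | hc⟩
    · rw [hc]; exact ev c (by omega)
    · have h := od (m - c) (by omega)
      rwa [show n + 1 - 2 * (m - c) = (j : ℕ) + 1 by omega] at h
  · rintro ⟨m, hm⟩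
    let y : ℕ → F := fun k => if k ≤ n then triSol α β k else 0
    have y0 : y 0 = 0 := by simp [y, triSol]
    have yn : y (n + 1) = 0 := by simp [y]
    refine ⟨fun j : Fin n => y ((j : ℕ) + 1), ?_, ?_⟩
    · intro h
      have h0 := congrFun h ⟨0, by omega⟩
      simp [y, triSol, hn1] at h0
    · funext i
      rw [tri_row n α β A hA y y0 yn i]
      have hi := i.2
      show _ = (0 : F)
      by_cases h : (i : ℕ) + 2 ≤ n
      · have ha := hα ((i : ℕ) + 1) (by omega) (by omega)
        simp only [y, if_pos h, if_pos hi.le, triSol]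
        rw [mul_div_cancel₀ _ ha]
        ring
      · have h2 : (i : ℕ) = 2 * m := by omega
        simp only [y, if_neg h, if_pos hi.le]
        rw [h2, triSol_even]; simp
end

section
/- Let F be a field, n ≥ 1 odd, and let A be the n×n matrix over F with entries A_{i,i+1} = α_i, A_{i+1,i} = β_i (1 ≤ i ≤ n−1), all other entries 0, where all α_i and β_i are nonzero. Then the solution space of AX = 0 is one-dimensional, spanned by the vector X = (x_1, …, x_n)ᵀ with x_i = 0 for i even, x_1 = 1, and x_i = (−1)^{(i−1)/2} (∏_{j=1}^{(i−1)/2} β_{2j−1}) / (∏_{j=1}^{(i−1)/2} α_{2j}) for i odd, i ≥ 3. -/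
def extz {F : Type*} [Field F] {n : ℕ} (y : Fin n → F) (k : ℕ) : F :=
  if h : k < n then y ⟨k, h⟩ else 0

lemma row_formula {F : Type*} [Field F] {n : ℕ} (α β : ℕ → F)
    (A : Matrix (Fin n) (Fin n) F)
    (hA : ∀ i j : Fin n,
      A i j = if (j : ℕ) = (i : ℕ) + 1 then α ((i : ℕ) + 1)
        else if (i : ℕ) = (j : ℕ) + 1 then β ((j : ℕ) + 1) else 0)
    (y : Fin n → F) (i : Fin n) :
    A.mulVec y i = (if (i : ℕ) = 0 then 0 else β i * extz y (i - 1))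
      + α (i + 1) * extz y (i + 1) := by
  have h1 : A.mulVec y i = ∑ j : Fin n,
      (fun k : ℕ => (if k = (i : ℕ) - 1 then
        (if (i : ℕ) = 0 then 0 else β i * extz y (i - 1)) else 0)
      + (if k = (i : ℕ) + 1 then α (i + 1) * extz y (i + 1) else 0)) j := by
    unfold Matrix.mulVec dotProduct
    refine Finset.sum_congr rfl fun j _ => ?_
    have hj : y j = extz y j := by simp [extz]
    change A i j * y j = _
    rw [hA, hj]
    dsimp only
    by_cases h : (j : ℕ) = i + 1
    · have h2 : ¬ (j : ℕ) = i - 1 := by omega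
      rw [if_pos h, if_pos h, if_neg h2, h, zero_add]
    · rw [if_neg h, if_neg h, add_zero]
      by_cases h3 : (i : ℕ) = j + 1
      · have h4 : (j : ℕ) = i - 1 := by omega
        have h5 : ¬ (i : ℕ) = 0 := by omega
        rw [if_pos h3, if_pos h4, if_neg h5, ← h4, ← h3]
      · rw [if_neg h3, zero_mul]
        by_cases h5 : (i : ℕ) = 0
        · simp [h5]
        · rw [if_neg (by omega)]
  refine h1.trans ((Fin.sum_univ_eq_sum_range
      (fun k : ℕ => (if k = (i : ℕ) - 1 then
        (if (i : ℕ) = 0 then 0 else β i * extz y (i - 1)) else 0)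
      + (if k = (i : ℕ) + 1 then α (i + 1) * extz y (i + 1) else 0)) n).trans ?_)
  rw [Finset.sum_add_distrib, Finset.sum_ite_eq',
    Finset.sum_ite_eq']
  have := i.2
  rw [if_pos (by simp; omega)]
  congr 1
  by_cases h : (i : ℕ) + 1 < n
  · rw [if_pos (by simpa using h)]
  · rw [if_neg (by simpa using h)]
    simp [extz, h]

/-- For an odd-size tridiagonal matrix over a field with zero
diagonal and nonzero super- and subdiagonal entries, the solution space of
`A X = 0` is one-dimensional, spanned by the explicit vector whose 1-indexed
entries are `x_i = 0` for `i` even, `x_1 = 1`, and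
`x_i = (−1)^((i−1)/2) (∏_{j=1}^{(i−1)/2} β_{2j−1}) / (∏_{j=1}^{(i−1)/2} α_{2j})`
for odd `i ≥ 3`.  (Here the `Fin n` index `i` corresponds to the 1-indexed
entry `i + 1`.) -/
theorem tridiagonal_kernel_span_odd
    (F : Type*) [Field F] (n : ℕ) (hn1 : 1 ≤ n) (hodd : Odd n)
    (α β : ℕ → F)
    (hα : ∀ i : ℕ, 1 ≤ i → i ≤ n - 1 → α i ≠ 0)
    (hβ : ∀ i : ℕ, 1 ≤ i → i ≤ n - 1 → β i ≠ 0)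
    (A : Matrix (Fin n) (Fin n) F)
    (hA : ∀ i j : Fin n,
      A i j = if (j : ℕ) = (i : ℕ) + 1 then α ((i : ℕ) + 1)
        else if (i : ℕ) = (j : ℕ) + 1 then β ((j : ℕ) + 1) else 0)
    (x : Fin n → F)
    (hx : ∀ i : Fin n,
      x i = if Even (i : ℕ) then
          (-1 : F) ^ ((i : ℕ) / 2) *
            (∏ j ∈ Finset.Icc 1 ((i : ℕ) / 2), β (2 * j - 1)) /
            (∏ j ∈ Finset.Icc 1 ((i : ℕ) / 2), α (2 * j))
        else 0) :
    Module.finrank F (LinearMap.ker A.mulVecLin) = 1 ∧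
      LinearMap.ker A.mulVecLin = Submodule.span F {x} := by
  have row := row_formula α β A hA
  have ker_iff : ∀ y : Fin n → F, y ∈ LinearMap.ker A.mulVecLin ↔ ∀ i : ℕ, i < n →
      (if i = 0 then 0 else β i * extz y (i - 1)) + α (i + 1) * extz y (i + 1) = 0 := by
    intro y
    rw [LinearMap.mem_ker, Matrix.mulVecLin_apply, funext_iff]
    constructor
    · intro h i hi
      have := h ⟨i, hi⟩
      rwa [row] at this
    · intro h i
      rw [row]
      exact h i i.2
  have x0 : extz x 0 = 1 := by
    have : 0 < n := hn1
    simp [extz, this, hx]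
  have xodd : ∀ k, ¬ Even k → extz x k = 0 := by
    intro k hk
    unfold extz
    split_ifs with h
    · rw [hx, if_neg hk]
    · rfl
  have xstep : ∀ k, 2 * k + 2 < n →
      β (2 * k + 1) * extz x (2 * k) + α (2 * k + 2) * extz x (2 * k + 2) = 0 := by
    intro k hk
    have e1 : Even (2 * k) := by simp
    have e2 : Even (2 * k + 2) := ⟨k + 1, by ring⟩
    have d1 : 2 * k / 2 = k := by omega
    have d2 : (2 * k + 2) / 2 = k + 1 := by omega
    have d3 : 2 * (k + 1) - 1 = 2 * k + 1 := by omega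
    have d4 : 2 * (k + 1) = 2 * k + 2 := by omega
    have hk' : 2 * k < n := by omega
    have ha : α (2 * k + 2) ≠ 0 := hα _ (by omega) (by omega)
    have hp : (∏ j ∈ Finset.Icc 1 k, α (2 * j)) ≠ 0 := by
      rw [Finset.prod_ne_zero_iff]
      intro j hj
      rw [Finset.mem_Icc] at hj
      exact hα _ (by omega) (by omega)
    unfold extz
    rw [dif_pos hk, dif_pos hk', hx, hx]
    dsimp only
    rw [if_pos e1, if_pos e2, d1, d2, Finset.prod_Icc_succ_top (by omega),
      Finset.prod_Icc_succ_top (by omega), d3, d4]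
    field_simp
    ring
  have xmem : x ∈ LinearMap.ker A.mulVecLin := by
    rw [ker_iff]
    intro i hi
    rcases Nat.even_or_odd' i with ⟨k, rfl | rfl⟩
    · rw [xodd (2 * k + 1) (by simp)]
      split_ifs with h
      · simp
      · rw [xodd (2 * k - 1) (by rw [Nat.not_even_iff]; omega)]
        simp
    · rw [if_neg (by omega)]
      obtain ⟨m, rfl⟩ := hodd
      exact xstep k (by omega)
  have key : LinearMap.ker A.mulVecLin = Submodule.span F {x} := by
    apply le_antisymm
    · intro y hy
      rw [ker_iff] at hy
      rw [Submodule.mem_span_singleton]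
      refine ⟨extz y 0, ?_⟩
      have odds : ∀ k, 2 * k + 1 < n → extz y (2 * k + 1) = 0 := by
        intro k
        induction k with
        | zero =>
          intro h
          have := hy 0 (by omega)
          simpa [hα 1 le_rfl (by omega)] using this
        | succ k ih =>
          intro h
          have h2 := hy (2 * (k + 1)) (by omega)
          rw [if_neg (by omega), show 2 * (k + 1) - 1 = 2 * k + 1 by omega, ih (by omega),
            mul_zero, zero_add] at h2
          exact (mul_eq_zero.mp h2).resolve_left (hα _ (by omega) (by omega))
      have evens : ∀ k, 2 * k < n → extz y (2 * k) = extz y 0 * extz x (2 * k) := by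
        intro k
        induction k with
        | zero => intro _; simp [x0]
        | succ k ih =>
          intro h
          have h2 := hy (2 * k + 1) (by omega)
          rw [if_neg (by omega), Nat.add_sub_cancel, ih (by omega)] at h2
          have h3 := xstep k (by omega)
          have ha : α (2 * k + 2) ≠ 0 := hα _ (by omega) (by omega)
          apply mul_left_cancel₀ ha
          change α (2 * k + 2) * extz y (2 * k + 2) = α (2 * k + 2) * (extz y 0 * extz x (2 * k + 2))
          change _ + α (2 * k + 2) * extz y (2 * k + 2) = 0 at h2
          linear_combination h2 - extz y 0 * h3
      funext i
      have e1 : x i = extz x i := by simp [extz]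
      have e2 : y i = extz y i := by simp [extz]
      have hi := i.2
      rw [Pi.smul_apply, smul_eq_mul, e1, e2]
      rcases Nat.even_or_odd' (i : ℕ) with ⟨k, hk | hk⟩
      · rw [hk] at hi ⊢
        exact (evens k hi).symm
      · rw [hk] at hi ⊢
        rw [odds k hi, xodd _ (by simp), mul_zero]
    · rw [Submodule.span_singleton_le_iff_mem]
      exact xmem
  refine ⟨?_, key⟩
  rw [key]
  apply finrank_span_singleton
  intro h
  rw [h] at x0
  simp [extz] at x0
end

section
/- Let q, t, u, α, β, γ ∈ ℂ with q ≠ 0, t ≠ 0, t² = −q, and u ≠ 0, and let i denote the imaginary unit. Let M be the 3×3 complex matrix with rows (−γ(q+1), −βu, 0), (−αu⁻¹, −2γ, −iβt⁻¹u), (0, iαt⁻¹u⁻¹, −γ(1+q⁻¹)). Then det(M) = −2γ³(1+q)²/q; in particular, if moreover q ≠ −1, then det(M) = 0 if and only if γ = 0. -/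
open Complex

/-- the determinant of the matrix `R_{x_{αβγ}}(3)` of display (3.7)
equals `−2γ³(1+q)²/q`; in particular if `q ≠ −1` it vanishes iff `γ = 0`. -/
theorem det_Rxabc_three
    (q t u α β γ : ℂ) (hq : q ≠ 0) (ht : t ≠ 0) (ht2 : t ^ 2 = -q) (hu : u ≠ 0)
    (M : Matrix (Fin 3) (Fin 3) ℂ)
    (hM : M = !![-γ * (q + 1), -β * u, 0;
                 -α * u⁻¹, -2 * γ, -Complex.I * β * t⁻¹ * u;
                 0, Complex.I * α * t⁻¹ * u⁻¹, -γ * (1 + q⁻¹)]) :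
    M.det = -2 * γ ^ 3 * (1 + q) ^ 2 / q ∧
      (q ≠ -1 → (M.det = 0 ↔ γ = 0)) := by
  have key : M.det = -2 * γ ^ 3 * (1 + q) ^ 2 / q := by
    have hfh : (-Complex.I * β * t⁻¹ * u) * (Complex.I * α * t⁻¹ * u⁻¹) = -(α * β * q⁻¹) := by
      have h1 : t⁻¹ * t⁻¹ = -q⁻¹ := by
        rw [← mul_inv, ← pow_two, ht2, inv_neg]
      have h2 : u * u⁻¹ = 1 := mul_inv_cancel₀ hu
      calc _ = -(Complex.I * Complex.I) * α * β * (t⁻¹ * t⁻¹) * (u * u⁻¹) := by ring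
        _ = _ := by rw [h1, h2, Complex.I_mul_I]; ring
    have hbd : (-β * u) * (-α * u⁻¹) = α * β := by
      field_simp
    have hd : M.det = (-γ * (q + 1)) * ((-2 * γ) * (-γ * (1 + q⁻¹))
        - (-Complex.I * β * t⁻¹ * u) * (Complex.I * α * t⁻¹ * u⁻¹))
        - ((-β * u) * (-α * u⁻¹)) * (-γ * (1 + q⁻¹)) := by
      rw [hM, Matrix.det_fin_three]
      simp
      ring
    rw [hd, hfh, hbd]
    field_simp
    ring
  refine ⟨key, fun hq1 => ?_⟩
  have h1 : (1 + q) ≠ 0 := fun h => hq1 (by linear_combination h)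
  rw [key]
  simp [hq, h1]
end

section
/- Fix q ∈ ℂ with q ≠ 0 and q not a root of unity, and fix t ∈ ℂ with t² = −q. Let 𝒜 be the quotient of the free ℂ-algebra on five generators a, b, c, d, σ by the two-sided ideal generated by the relations ab − tba, ac − tca, bc + cb, bd + tdb, cd + tdc, ad − da − (t⁻¹ − t)bc, ad + tbc − σ, σ² − 1. Then the images of the monomials a^i b^j c^k d^l σ^s, where i, j, k, l ∈ ℕ with i = 0 or l = 0, and s ∈ {0, 1}, form a ℂ-vector-space basis of 𝒜. -/
noncomputable section

/-- Generators of the free algebra on `a, b, c, d, σ` (indexed `0,…,4`). -/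
def Agen (i : Fin 5) : FreeAlgebra ℂ (Fin 5) := FreeAlgebra.ι ℂ i

/-- The defining relations (2.5) of `ℂ_q[osp(1,2)]`: each constructor `u ~ v`
corresponds to the generator `u − v` of the two-sided ideal. -/
inductive ARel (q t : ℂ) : FreeAlgebra ℂ (Fin 5) → FreeAlgebra ℂ (Fin 5) → Prop
  | ab : ARel q t (Agen 0 * Agen 1) (t • (Agen 1 * Agen 0))
  | ac : ARel q t (Agen 0 * Agen 2) (t • (Agen 2 * Agen 0))
  | bc : ARel q t (Agen 1 * Agen 2) (-(Agen 2 * Agen 1))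
  | bd : ARel q t (Agen 1 * Agen 3) (-(t • (Agen 3 * Agen 1)))
  | cd : ARel q t (Agen 2 * Agen 3) (-(t • (Agen 3 * Agen 2)))
  | adda : ARel q t (Agen 0 * Agen 3 - Agen 3 * Agen 0) ((t⁻¹ - t) • (Agen 1 * Agen 2))
  | sigma : ARel q t (Agen 0 * Agen 3 + t • (Agen 1 * Agen 2)) (Agen 4)
  | sigmaSq : ARel q t (Agen 4 * Agen 4) 1

/-- The quantum supergroup `𝒜 = ℂ_q[osp(1,2)]`, the quotient of the free algebra
by the two-sided ideal generated by the relations. -/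
abbrev QuantumA (q t : ℂ) := RingQuot (ARel q t)

/-- Images of the generators `a, b, c, d, σ` in `𝒜`. -/
def agen (q t : ℂ) (i : Fin 5) : QuantumA q t :=
  RingQuot.mkAlgHom ℂ (ARel q t) (Agen i)

/-- Index type of the claimed basis: `(i, j, k, l, s)` with `i = 0` or `l = 0`. -/
def AIdx : Type := {p : ℕ × ℕ × ℕ × ℕ × Fin 2 // p.1 = 0 ∨ p.2.2.2.1 = 0}

/-- The monomial `a^i b^j c^k d^l σ^s` in `𝒜`. -/
def Amono (q t : ℂ) (p : AIdx) : QuantumA q t :=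
  agen q t 0 ^ p.1.1 * agen q t 1 ^ p.1.2.1 * agen q t 2 ^ p.1.2.2.1 *
    agen q t 3 ^ p.1.2.2.2.1 * agen q t 4 ^ (p.1.2.2.2.2 : ℕ)


abbrev VV := (ℤ × ℕ × ℕ × Fin 2) →₀ ℂ

def ee (n : ℤ) (j k : ℕ) (s : Fin 2) : VV := Finsupp.single (n, j, k, s) 1

def mkOp {M : Type*} [AddCommGroup M] [Module ℂ M] (f : ℤ → ℕ → ℕ → Fin 2 → M) : VV →ₗ[ℂ] M :=
  Finsupp.linearCombination ℂ (fun p => f p.1 p.2.1 p.2.2.1 p.2.2.2)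

theorem mkOp_ee {M : Type*} [AddCommGroup M] [Module ℂ M] (f : ℤ → ℕ → ℕ → Fin 2 → M)
    (n j k s) : mkOp f (ee n j k s) = f n j k s := by
  simp [mkOp, ee]

theorem VV_ext {M : Type*} [AddCommGroup M] [Module ℂ M] {f g : VV →ₗ[ℂ] M}
    (h : ∀ n j k s, f (ee n j k s) = g (ee n j k s)) : f = g := by
  apply Finsupp.lhom_ext'
  rintro ⟨n, j, k, s⟩
  apply LinearMap.ext_ring
  exact h n j k s

theorem fin2 (s : Fin 2) : s + 1 + 1 = s := by
  fin_cases s <;> rfl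

def opB : VV →ₗ[ℂ] VV := mkOp fun n j k s => ee n (j+1) k s
def opC : VV →ₗ[ℂ] VV := mkOp fun n j k s => (-1 : ℂ)^j • ee n j (k+1) s
def opS : VV →ₗ[ℂ] VV := mkOp fun n j k s => (-1 : ℂ)^(j+k) • ee n j k (s+1)
def opA (t : ℂ) : VV →ₗ[ℂ] VV := mkOp fun n j k s => if 0 ≤ n then t^(j+k) • ee (n+1) j k s
  else t^(j+k) • (ee (n+1) j k (s+1) - (t * (-1)^k) • ee (n+1) (j+1) (k+1) s)
def opD (t : ℂ) : VV →ₗ[ℂ] VV := mkOp fun n j k s =>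
  if n ≤ 0 then ((-1)^(j+k) * t⁻¹^(j+k)) • ee (n-1) j k s
  else ((-1)^(j+k) * t⁻¹^(j+k)) • (ee (n-1) j k (s+1) - (t⁻¹ * (-1)^k) • ee (n-1) (j+1) (k+1) s)

theorem neg1_sq (k : ℕ) : ((-1 : ℂ)^k)^2 = 1 := by
  rw [← pow_mul, mul_comm, pow_mul]; simp

theorem opB_ee (n j k s) : opB (ee n j k s) = ee n (j+1) k s := mkOp_ee _ _ _ _ _
theorem opC_ee (n j k s) : opC (ee n j k s) = (-1 : ℂ)^j • ee n j (k+1) s := mkOp_ee _ _ _ _ _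
theorem opS_ee (n j k s) : opS (ee n j k s) = (-1 : ℂ)^(j+k) • ee n j k (s+1) := mkOp_ee _ _ _ _ _
theorem opA_ee_pos (t : ℂ) (n j k s) (h : 0 ≤ n) :
    opA t (ee n j k s) = t^(j+k) • ee (n+1) j k s := by
  simp [opA, mkOp_ee, h]
theorem opA_ee_neg (t : ℂ) (n j k s) (h : n < 0) : opA t (ee n j k s) =
    t^(j+k) • (ee (n+1) j k (s+1) - (t * (-1)^k) • ee (n+1) (j+1) (k+1) s) := by
  rw [opA, mkOp_ee, if_neg (by omega)]
theorem opD_ee_neg (t : ℂ) (n j k s) (h : n ≤ 0) :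
    opD t (ee n j k s) = ((-1)^(j+k) * t⁻¹^(j+k)) • ee (n-1) j k s := by
  rw [opD, mkOp_ee, if_pos h]
theorem opD_ee_pos (t : ℂ) (n j k s) (h : 0 < n) : opD t (ee n j k s) =
    ((-1)^(j+k) * t⁻¹^(j+k)) •
      (ee (n-1) j k (s+1) - (t⁻¹ * (-1)^k) • ee (n-1) (j+1) (k+1) s) := by
  rw [opD, mkOp_ee, if_neg (by omega)]

theorem r_bc : opB * opC = -(opC * opB) := by
  apply VV_ext; intro n j k s
  simp only [Module.End.mul_apply, LinearMap.neg_apply, opB_ee, opC_ee, map_smul]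
  module

theorem r_ss : opS * opS = 1 := by
  apply VV_ext; intro n j k s
  simp only [Module.End.mul_apply, opS_ee, map_smul, fin2, Module.End.one_apply, smul_smul]
  rw [← sq, neg1_sq, one_smul]

theorem r_ab (t : ℂ) : opA t * opB = t • (opB * opA t) := by
  apply VV_ext; intro n j k s
  simp only [Module.End.mul_apply, LinearMap.smul_apply, opB_ee]
  rcases lt_or_ge n 0 with h | h
  · simp only [opA_ee_neg _ _ _ _ _ h, map_smul, map_sub, opB_ee]; module
  · simp only [opA_ee_pos _ _ _ _ _ h, map_smul, map_sub, opB_ee]; module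

theorem r_ac (t : ℂ) : opA t * opC = t • (opC * opA t) := by
  apply VV_ext; intro n j k s
  simp only [Module.End.mul_apply, LinearMap.smul_apply, opC_ee, map_smul]
  rcases lt_or_ge n 0 with h | h
  · simp only [opA_ee_neg _ _ _ _ _ h, map_smul, map_sub, opC_ee]; module
  · simp only [opA_ee_pos _ _ _ _ _ h, map_smul, map_sub, opC_ee]; module

theorem r_bd (t : ℂ) (h0 : t ≠ 0) : opB * opD t = -(t • (opD t * opB)) := by
  apply VV_ext; intro n j k s
  simp only [Module.End.mul_apply, LinearMap.smul_apply, opB_ee, LinearMap.neg_apply]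
  rcases lt_or_ge 0 n with h | h
  · simp only [opD_ee_pos _ _ _ _ _ h, map_smul, map_sub, opB_ee]
    match_scalars <;> simp only [pow_add, pow_one, pow_succ] <;> field_simp
  · simp only [opD_ee_neg _ _ _ _ _ h, map_smul, map_sub, opB_ee]
    match_scalars <;> simp only [pow_add, pow_one, pow_succ] <;> field_simp

theorem r_cd (t : ℂ) (h0 : t ≠ 0) : opC * opD t = -(t • (opD t * opC)) := by
  apply VV_ext; intro n j k s
  simp only [Module.End.mul_apply, LinearMap.smul_apply, opC_ee, LinearMap.neg_apply, map_smul]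
  rcases lt_or_ge 0 n with h | h
  · simp only [opD_ee_pos _ _ _ _ _ h, map_smul, map_sub, opC_ee]
    match_scalars <;> simp only [pow_add, pow_one, pow_succ] <;> field_simp
  · simp only [opD_ee_neg _ _ _ _ _ h, map_smul, map_sub, opC_ee]
    match_scalars <;> simp only [pow_add, pow_one, pow_succ] <;> field_simp

theorem r_ad (t : ℂ) (h0 : t ≠ 0) : opA t * opD t + t • (opB * opC) = opS := by
  apply VV_ext; intro n j k s
  have h1 := neg1_sq j
  have h2 := neg1_sq k
  simp only [Module.End.mul_apply, LinearMap.smul_apply, LinearMap.add_apply, opC_ee, opS_ee,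
    opB_ee, map_smul]
  rcases lt_or_ge 0 n with h | h
  · simp only [opD_ee_pos _ _ _ _ _ h, map_smul, map_sub, opA_ee_pos _ (n-1) _ _ _ (by omega),
      sub_add_cancel]
    match_scalars <;> simp only [pow_add, pow_one, pow_succ, inv_pow] <;> field_simp <;> grind
  · simp only [opD_ee_neg _ _ _ _ _ h, map_smul, map_sub, opA_ee_neg _ (n-1) _ _ _ (by omega),
      sub_add_cancel]
    match_scalars <;> simp only [pow_add, pow_one, pow_succ, inv_pow] <;> field_simp <;> grind

theorem r_da (t : ℂ) (h0 : t ≠ 0) : opD t * opA t + t⁻¹ • (opB * opC) = opS := by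
  apply VV_ext; intro n j k s
  have h1 := neg1_sq j
  have h2 := neg1_sq k
  simp only [Module.End.mul_apply, LinearMap.smul_apply, LinearMap.add_apply, opC_ee, opS_ee,
    opB_ee, map_smul]
  rcases lt_or_ge n 0 with h | h
  · simp only [opA_ee_neg _ _ _ _ _ h, map_smul, map_sub, opD_ee_neg _ (n+1) _ _ _ (by omega),
      add_sub_cancel_right]
    match_scalars <;> simp only [pow_add, pow_one, pow_succ, inv_pow] <;> field_simp <;> grind
  · simp only [opA_ee_pos _ _ _ _ _ h, map_smul, map_sub, opD_ee_pos _ (n+1) _ _ _ (by omega),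
      add_sub_cancel_right]
    match_scalars <;> simp only [pow_add, pow_one, pow_succ, inv_pow] <;> field_simp <;> grind

theorem r_adda (t : ℂ) (h0 : t ≠ 0) :
    opA t * opD t - opD t * opA t = (t⁻¹ - t) • (opB * opC) := by
  apply LinearMap.ext
  intro v
  have h1 := LinearMap.congr_fun (r_ad t h0) v
  have h2 := LinearMap.congr_fun (r_da t h0) v
  simp only [LinearMap.add_apply, LinearMap.sub_apply, LinearMap.smul_apply] at h1 h2 ⊢
  rw [eq_sub_of_add_eq h1, eq_sub_of_add_eq h2]
  module

def opG (t : ℂ) : Fin 5 → Module.End ℂ VV := ![opA t, opB, opC, opD t, opS]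

theorem exists_rep (q t : ℂ) (h0 : t ≠ 0) :
    ∃ ρ : QuantumA q t →ₐ[ℂ] Module.End ℂ VV, ∀ i, ρ (agen q t i) = opG t i := by
  refine ⟨RingQuot.liftAlgHom ℂ ⟨FreeAlgebra.lift ℂ (opG t), ?_⟩, ?_⟩
  · intro x y h
    have hl : ∀ i, FreeAlgebra.lift ℂ (opG t) (Agen i) = opG t i := fun i => by simp [Agen]
    have ha : opG t 0 = opA t := rfl
    have hb : opG t 1 = opB := rfl
    have hc : opG t 2 = opC := rfl
    have hd : opG t 3 = opD t := rfl
    have hs : opG t 4 = opS := rfl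
    induction h <;> simp only [map_mul, map_smul, map_neg, map_sub, map_add, map_one, hl,
      ha, hb, hc, hd, hs]
    · exact r_ab t
    · exact r_ac t
    · exact r_bc
    · exact r_bd t h0
    · exact r_cd t h0
    · exact r_adda t h0
    · exact r_ad t h0
    · exact r_ss
  · intro i
    simp [agen, Agen]

section alg
variable {R : Type*} [Ring R] [Algebra ℂ R]

theorem qcomm (x y : R) (r : ℂ) (h : x * y = r • (y * x)) (n : ℕ) :
    x * y ^ n = r ^ n • (y ^ n * x) := by
  induction n with
  | zero => simp
  | succ n ih =>
    rw [pow_succ, ← mul_assoc, ih, smul_mul_assoc, mul_assoc, h, mul_smul_comm, smul_smul, mul_assoc,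
      pow_succ]

def uu (a d : R) (n : ℤ) : R := if 0 ≤ n then a ^ n.toNat else d ^ (-n).toNat

theorem uu_nonneg (a d : R) (n : ℕ) : uu a d n = a ^ n := by simp [uu]
theorem uu_neg (a d : R) (n : ℕ) : uu a d (-n) = d ^ n := by
  rcases n with _ | n
  · simp [uu]
  · rw [uu, if_neg (by omega)]; simp

end alg


section alg2
variable {R : Type*} [Ring R] [Algebra ℂ R]

theorem qcomm2 (x y : R) (r : ℂ) (h : x * y = r • (y * x)) (n : ℕ) :
    x ^ n * y = r ^ n • (y * x ^ n) := by
  induction n with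
  | zero => simp
  | succ n ih =>
    rw [pow_succ, mul_assoc, h, mul_smul_comm, ← mul_assoc, ih, smul_mul_assoc, smul_smul,
      mul_assoc, pow_succ, mul_comm]

structure Rels (t : ℂ) (a b c d s : R) : Prop where
  t0 : t ≠ 0
  ab : a * b = t • (b * a)
  ac : a * c = t • (c * a)
  bc : b * c = -(c * b)
  bd : b * d = -(t • (d * b))
  cd : c * d = -(t • (d * c))
  adda : a * d - d * a = (t⁻¹ - t) • (b * c)
  sg : a * d + t • (b * c) = s
  ss : s * s = 1

namespace Rels
variable {t : ℂ} {a b c d s : R} (H : Rels t a b c d s)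
include H

theorem ad : a * d = s - t • (b * c) := eq_sub_of_add_eq H.sg
theorem da : d * a = s - t⁻¹ • (b * c) := by
  have h := H.adda
  rw [H.ad] at h
  have h2 : d * a = s - t • (b * c) - (t⁻¹ - t) • (b * c) := by rw [← h]; abel
  rw [h2]; module
theorem db : d * b = (-t⁻¹) • (b * d) := by
  rw [H.bd, smul_neg, smul_smul, neg_mul, inv_mul_cancel₀ H.t0]; simp
theorem dc : d * c = (-t⁻¹) • (c * d) := by
  rw [H.cd, smul_neg, smul_smul, neg_mul, inv_mul_cancel₀ H.t0]; simp
theorem cb : c * b = (-1 : ℂ) • (b * c) := by rw [H.bc]; simp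
theorem sb : s * b = (-1 : ℂ) • (b * s) := by
  have h0 := H.t0
  rw [← H.sg, add_mul, mul_add, mul_assoc, H.db, mul_smul_comm, ← mul_assoc, H.ab, smul_mul_assoc,
    smul_mul_assoc, mul_assoc b c b, H.cb, mul_smul_comm, mul_smul_comm, smul_smul, mul_assoc b a d,
    neg_mul, inv_mul_cancel₀ h0]
  module
theorem sc : s * c = (-1 : ℂ) • (c * s) := by
  have h0 := H.t0
  rw [← H.sg, add_mul, mul_add, mul_assoc, H.dc, mul_smul_comm, ← mul_assoc, H.ac, smul_mul_assoc,
    smul_mul_assoc, mul_smul_comm, ← mul_assoc c b c, H.cb, smul_mul_assoc, smul_smul,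
    mul_assoc c a d, neg_mul, inv_mul_cancel₀ h0]
  module
theorem bca : a * (b * c) = (t ^ 2) • (b * c * a) := by
  rw [← mul_assoc, H.ab, smul_mul_assoc, mul_assoc, H.ac, mul_smul_comm, smul_smul, sq, mul_assoc]
theorem dbc : d * (b * c) = (t⁻¹ ^ 2) • (b * c * d) := by
  rw [← mul_assoc, H.db, smul_mul_assoc, mul_assoc, H.dc, mul_smul_comm, smul_smul, mul_assoc]
  congr 1; ring
theorem as : a * s = s * a := by
  have h0 := H.t0
  have h1 : a * s = a * (d * a + t⁻¹ • (b * c)) := by rw [H.da]; congr 1; abel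
  rw [h1, mul_add, ← mul_assoc, H.ad, mul_smul_comm, H.bca, sub_mul, smul_mul_assoc, smul_smul]
  rw [show t⁻¹ * t ^ 2 = t by field_simp]; abel
theorem ds : d * s = s * d := by
  have h0 := H.t0
  have h1 : d * s = d * (a * d + t • (b * c)) := by rw [H.ad]; congr 1; abel
  rw [h1, mul_add, ← mul_assoc, H.da, mul_smul_comm, H.dbc, sub_mul, smul_mul_assoc, smul_smul]
  rw [show t * t⁻¹ ^ 2 = t⁻¹ by field_simp]; abel

/-- moving past `b^j c^k s^m` -/
theorem past (x : R) (r r' : ℂ) (h1 : x * b = r • (b * x)) (h2 : x * c = r • (c * x))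
    (h3 : x * s = r' • (s * x)) (j k m : ℕ) :
    x * (b ^ j * c ^ k * s ^ m) = (r ^ (j + k) * r' ^ m) • (b ^ j * c ^ k * s ^ m * x) := by
  rw [← mul_assoc, ← mul_assoc, qcomm x b r h1, smul_mul_assoc, smul_mul_assoc, mul_assoc (b ^ j) x,
    qcomm x c r h2, mul_smul_comm, smul_mul_assoc, smul_smul, ← mul_assoc, mul_assoc _ x,
    qcomm x s r' h3, mul_smul_comm, smul_smul, ← mul_assoc, pow_add]

theorem pastA (j k m : ℕ) : a * (b ^ j * c ^ k * s ^ m) =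
    t ^ (j + k) • (b ^ j * c ^ k * s ^ m * a) := by
  rw [H.past a t 1 H.ab H.ac (by rw [H.as, one_smul])]; simp
theorem pastD (j k m : ℕ) : d * (b ^ j * c ^ k * s ^ m) =
    ((-1) ^ (j + k) * t⁻¹ ^ (j + k)) • (b ^ j * c ^ k * s ^ m * d) := by
  rw [H.past d (-t⁻¹) 1 H.db H.dc (by rw [H.ds, one_smul])]; rw [neg_pow]; simp

theorem s_fin (m : Fin 2) : s ^ (m : ℕ) * s = s ^ ((m + 1 : Fin 2) : ℕ) := by
  fin_cases m
  · simp
  · simp [H.ss]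

theorem pastBC (j k m : ℕ) : b ^ j * c ^ k * s ^ m * (b * c) =
    (-1 : ℂ) ^ k • (b ^ (j + 1) * c ^ (k + 1) * s ^ m) := by
  have h1 : s ^ m * (b * c) = (b * c) * s ^ m := by
    have : Commute s (b * c) := by
      rw [commute_iff_eq, ← mul_assoc, H.sb, smul_mul_assoc, mul_assoc, H.sc, mul_smul_comm,
        smul_smul, mul_assoc]; simp
    exact (this.pow_left m).eq
  have h2 := qcomm2 c b (-1) H.cb k
  rw [mul_assoc, h1, ← mul_assoc, ← mul_assoc, mul_assoc (b ^ j), h2, mul_smul_comm, smul_mul_assoc,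
    smul_mul_assoc, pow_succ, pow_succ]
  simp only [mul_assoc]

omit H in
theorem uu_succ (n : ℤ) (h : 0 ≤ n) : uu a d (n + 1) = a * uu a d n := by
  lift n to ℕ using h
  rw [show (n : ℤ) + 1 = ((n + 1 : ℕ) : ℤ) by simp, uu_nonneg, uu_nonneg, pow_succ']
omit H in
theorem uu_pred (n : ℤ) (h : n ≤ 0) : uu a d (n - 1) = d * uu a d n := by
  obtain ⟨m, rfl⟩ : ∃ m : ℕ, n = -m := ⟨(-n).toNat, by omega⟩
  rw [show -(m : ℤ) - 1 = -((m + 1 : ℕ) : ℤ) by push_cast; ring, uu_neg, uu_neg, pow_succ']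

theorem a_uu (n : ℤ) (h : n < 0) : a * uu a d n = (s - t • (b * c)) * uu a d (n + 1) := by
  have := uu_pred (a := a) (d := d) (n + 1) (by omega)
  rw [add_sub_cancel_right] at this
  rw [this, ← mul_assoc, H.ad]
theorem d_uu (n : ℤ) (h : 0 < n) : d * uu a d n = (s - t⁻¹ • (b * c)) * uu a d (n - 1) := by
  have := uu_succ (a := a) (d := d) (n - 1) (by omega)
  rw [sub_add_cancel] at this
  rw [this, ← mul_assoc, H.da]

end Rels

def psi (a b c d s : R) : VV →ₗ[ℂ] R :=
  mkOp fun n j k m => b ^ j * c ^ k * s ^ (m : ℕ) * uu a d n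

theorem psi_ee (a b c d s : R) (n j k m) :
    psi a b c d s (ee n j k m) = b ^ j * c ^ k * s ^ (m : ℕ) * uu a d n := mkOp_ee _ _ _ _ _

namespace Rels
variable {t : ℂ} {a b c d s : R} (H : Rels t a b c d s)
include H

theorem psiB (v : VV) : b * psi a b c d s v = psi a b c d s (opB v) := by
  have : LinearMap.mulLeft ℂ b ∘ₗ psi a b c d s = psi a b c d s ∘ₗ opB := by
    apply VV_ext; intro n j k m
    simp only [LinearMap.comp_apply, LinearMap.mulLeft_apply, opB_ee, psi_ee, pow_succ', mul_assoc]
  exact LinearMap.congr_fun this v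

theorem psiC (v : VV) : c * psi a b c d s v = psi a b c d s (opC v) := by
  have : LinearMap.mulLeft ℂ c ∘ₗ psi a b c d s = psi a b c d s ∘ₗ opC := by
    apply VV_ext; intro n j k m
    simp only [LinearMap.comp_apply, LinearMap.mulLeft_apply, opC_ee, psi_ee, map_smul]
    simp only [← mul_assoc]
    rw [qcomm c b _ H.cb, pow_succ']
    simp only [mul_assoc, smul_mul_assoc]
  exact LinearMap.congr_fun this v

theorem psiS (v : VV) : s * psi a b c d s v = psi a b c d s (opS v) := by
  have : LinearMap.mulLeft ℂ s ∘ₗ psi a b c d s = psi a b c d s ∘ₗ opS := by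
    apply VV_ext; intro n j k m
    simp only [LinearMap.comp_apply, LinearMap.mulLeft_apply, opS_ee, psi_ee, map_smul]
    rw [← mul_assoc, H.past s (-1) 1 H.sb H.sc (by simp), mul_assoc _ _ s, H.s_fin, smul_mul_assoc]
    simp
  exact LinearMap.congr_fun this v

theorem psiA (v : VV) : a * psi a b c d s v = psi a b c d s (opA t v) := by
  have : LinearMap.mulLeft ℂ a ∘ₗ psi a b c d s = psi a b c d s ∘ₗ opA t := by
    apply VV_ext; intro n j k m
    simp only [LinearMap.comp_apply, LinearMap.mulLeft_apply, psi_ee]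
    rw [← mul_assoc, H.pastA, smul_mul_assoc, mul_assoc _ a]
    rcases lt_or_ge n 0 with h | h
    · rw [opA_ee_neg _ _ _ _ _ h, H.a_uu n h]
      simp only [map_smul, map_sub, psi_ee]
      rw [← mul_assoc, mul_sub, mul_smul_comm, H.pastBC, mul_assoc _ _ s, H.s_fin, sub_mul,
        smul_smul, smul_mul_assoc]
    · rw [opA_ee_pos _ _ _ _ _ h, map_smul, psi_ee, uu_succ n h]
  exact LinearMap.congr_fun this v

theorem psiD (v : VV) : d * psi a b c d s v = psi a b c d s (opD t v) := by
  have : LinearMap.mulLeft ℂ d ∘ₗ psi a b c d s = psi a b c d s ∘ₗ opD t := by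
    apply VV_ext; intro n j k m
    simp only [LinearMap.comp_apply, LinearMap.mulLeft_apply, psi_ee]
    rw [← mul_assoc, H.pastD, smul_mul_assoc, mul_assoc _ d]
    rcases lt_or_ge 0 n with h | h
    · rw [opD_ee_pos _ _ _ _ _ h, H.d_uu n h]
      simp only [map_smul, map_sub, psi_ee]
      rw [← mul_assoc, mul_sub, mul_smul_comm, H.pastBC, mul_assoc _ _ s, H.s_fin, sub_mul,
        smul_smul, smul_mul_assoc]
    · rw [opD_ee_neg _ _ _ _ _ h, map_smul, psi_ee, uu_pred n h]
  exact LinearMap.congr_fun this v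

theorem mono (i j k l : ℕ) (m : Fin 2) (h : i = 0 ∨ l = 0) :
    a ^ i * b ^ j * c ^ k * d ^ l * s ^ (m : ℕ) =
      (t ^ (j + k)) ^ i • psi a b c d s (ee (i - l) j k m) := by
  rw [psi_ee]
  rcases h with rfl | rfl
  · have : Commute d s := H.ds
    rw [mul_assoc _ (d ^ l), ((this.pow_left l).pow_right m).eq]
    simp [uu_neg, mul_assoc]
  · have := qcomm2 _ _ _ (H.pastA j k m) i
    simp only [pow_zero, mul_one, Nat.cast_zero, sub_zero, uu_nonneg]
    rw [← this]
    simp only [mul_assoc]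

end Rels
end alg2

theorem rels_A (q t : ℂ) (h0 : t ≠ 0) :
    Rels t (agen q t 0) (agen q t 1) (agen q t 2) (agen q t 3) (agen q t 4) := by
  have key : ∀ x y, ARel q t x y → RingQuot.mkAlgHom ℂ (ARel q t) x = RingQuot.mkAlgHom ℂ (ARel q t) y :=
    fun x y h => RingQuot.mkAlgHom_rel ℂ h
  refine ⟨h0, ?_, ?_, ?_, ?_, ?_, ?_, ?_, ?_⟩
  · simpa [agen] using key _ _ .ab
  · simpa [agen] using key _ _ .ac
  · simpa [agen] using key _ _ .bc
  · simpa [agen] using key _ _ .bd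
  · simpa [agen] using key _ _ .cd
  · simpa only [agen, map_mul, map_sub, map_smul] using key _ _ .adda
  · simpa [agen] using key _ _ .sigma
  · simpa [agen] using key _ _ .sigmaSq

def psiQ (q t : ℂ) : VV →ₗ[ℂ] QuantumA q t :=
  psi (agen q t 0) (agen q t 1) (agen q t 2) (agen q t 3) (agen q t 4)

theorem psiQ_equiv (q t : ℂ) (h0 : t ≠ 0) (ρ : QuantumA q t →ₐ[ℂ] Module.End ℂ VV)
    (hρ : ∀ i, ρ (agen q t i) = opG t i) (x : QuantumA q t) :
    ∀ v, x * psiQ q t v = psiQ q t (ρ x v) := by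
  obtain ⟨x, rfl⟩ := RingQuot.mkAlgHom_surjective ℂ (ARel q t) x
  have H := rels_A q t h0
  induction x using FreeAlgebra.induction with
  | grade0 r =>
    intro v
    simp only [AlgHom.commutes, Module.algebraMap_end_apply, map_smul, Algebra.smul_def]
  | grade1 i =>
    intro v
    change agen q t i * _ = psiQ q t (ρ (agen q t i) v)
    rw [hρ]
    fin_cases i
    · exact H.psiA v
    · exact H.psiB v
    · exact H.psiC v
    · exact H.psiD v
    · exact H.psiS v
  | mul x y hx hy => intro v; simp only [map_mul, mul_assoc, hy, hx, Module.End.mul_apply]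
  | add x y hx hy => intro v; simp only [map_add, add_mul, hy, hx, LinearMap.add_apply]

theorem powB (n j k s) : (opB ^ j) (ee n 0 k s) = ee n j k s := by
  induction j with
  | zero => simp
  | succ j ih => rw [pow_succ', Module.End.mul_apply, ih, opB_ee]
theorem powC (n k s) : (opC ^ k) (ee n 0 0 s) = ee n 0 k s := by
  induction k with
  | zero => simp
  | succ j ih => rw [pow_succ', Module.End.mul_apply, ih, opC_ee]; simp
theorem powS (n) (s : Fin 2) : (opS ^ (s : ℕ)) (ee n 0 0 0) = ee n 0 0 s := by
  fin_cases s
  · simp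
  · simp [opS_ee]
theorem powA (t : ℂ) (n : ℕ) : (opA t ^ n) (ee 0 0 0 0) = ee n 0 0 0 := by
  induction n with
  | zero => simp
  | succ j ih => rw [pow_succ', Module.End.mul_apply, ih, opA_ee_pos _ _ _ _ _ (by omega)]; simp
theorem powD (t : ℂ) (n : ℕ) : (opD t ^ n) (ee 0 0 0 0) = ee (-n) 0 0 0 := by
  induction n with
  | zero => simp
  | succ j ih =>
    rw [pow_succ', Module.End.mul_apply, ih, opD_ee_neg _ _ _ _ _ (by omega)]
    simp [sub_eq_add_neg, add_comm]

theorem rho_psi (q t : ℂ) (ρ : QuantumA q t →ₐ[ℂ] Module.End ℂ VV)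
    (hρ : ∀ i, ρ (agen q t i) = opG t i) (n j k s) :
    ρ (psiQ q t (ee n j k s)) (ee 0 0 0 0) = ee n j k s := by
  have hu : ρ (uu (agen q t 0) (agen q t 3) n) (ee 0 0 0 0) = ee n 0 0 0 := by
    rcases le_total 0 n with h | h
    · lift n to ℕ using h
      rw [uu_nonneg, map_pow, hρ]; exact powA t n
    · obtain ⟨m, rfl⟩ : ∃ m : ℕ, n = -m := ⟨(-n).toNat, by omega⟩
      rw [uu_neg, map_pow, hρ]; exact powD t m
  rw [psiQ, psi_ee, map_mul, map_mul, map_mul, Module.End.mul_apply, hu, map_pow, map_pow, map_pow,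
    hρ, hρ, hρ, Module.End.mul_apply, Module.End.mul_apply]
  change (opB ^ j) ((opC ^ k) ((opS ^ (s : ℕ)) _)) = _
  rw [powS, powC, powB]

def idx (p : AIdx) : ℤ × ℕ × ℕ × Fin 2 :=
  ((p.1.1 : ℤ) - p.1.2.2.2.1, p.1.2.1, p.1.2.2.1, p.1.2.2.2.2)

theorem idx_inj : Function.Injective idx := by
  rintro ⟨⟨i, j, k, l, s⟩, h⟩ ⟨⟨i', j', k', l', s'⟩, h'⟩ e
  simp only [idx, Prod.mk.injEq] at e h h'
  obtain ⟨e1, rfl, rfl, rfl⟩ := e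
  obtain rfl : i = i' := by omega
  obtain rfl : l = l' := by omega
  rfl

theorem idx_surj : Function.Surjective idx := by
  rintro ⟨n, j, k, s⟩
  refine ⟨⟨(n.toNat, j, k, (-n).toNat, s), ?_⟩, ?_⟩
  · change n.toNat = 0 ∨ (-n).toNat = 0
    omega
  · simp only [idx, Prod.mk.injEq, and_true]
    omega

/-- Theorem 2.2(1): the monomials `a^i b^j c^k d^l σ^s` with
`i = 0` or `l = 0` and `s ∈ {0,1}` form a ℂ-basis of `𝒜 = ℂ_q[osp(1,2)]`. -/
theorem quantumA_basis (q t : ℂ) (hq0 : q ≠ 0)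
    (hq : ∀ n : ℕ, 0 < n → q ^ n ≠ 1) (ht : t ^ 2 = -q) :
    LinearIndependent ℂ (Amono q t) ∧
      Submodule.span ℂ (Set.range (Amono q t)) = ⊤ := by
  have h0 : t ≠ 0 := by
    rintro rfl
    apply hq0
    rw [← neg_eq_zero, ← ht]; simp
  obtain ⟨ρ, hρ⟩ := exists_rep q t h0
  have hm : ∀ p : AIdx, Amono q t p =
      (t ^ (p.1.2.1 + p.1.2.2.1)) ^ p.1.1 • psiQ q t (Finsupp.single (idx p) 1) :=
    fun p => (rels_A q t h0).mono _ _ _ _ _ p.2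
  have hk : ∀ p : AIdx, (t ^ (p.1.2.1 + p.1.2.2.1)) ^ p.1.1 ≠ 0 :=
    fun p => pow_ne_zero _ (pow_ne_zero _ h0)
  constructor
  · let Φ : QuantumA q t →ₗ[ℂ] VV := (LinearMap.applyₗ (ee 0 0 0 0)) ∘ₗ ρ.toLinearMap
    apply LinearIndependent.of_comp Φ
    have h1 : LinearIndependent ℂ (fun p : AIdx => (Finsupp.single (idx p) 1 : VV)) :=
      (Finsupp.linearIndependent_single_one ℂ _).comp idx idx_inj
    have h2 := h1.units_smul (fun p => Units.mk0 _ (hk p))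
    convert h2 using 1
    funext p
    change ρ (Amono q t p) (ee 0 0 0 0) = (t ^ (p.1.2.1 + p.1.2.2.1)) ^ p.1.1 • _
    rw [hm, map_smul, LinearMap.smul_apply]
    congr 1
    exact rho_psi q t ρ hρ _ _ _ _
  · rw [eq_top_iff]
    rintro x -
    have h1 : psiQ q t (ee 0 0 0 0) = 1 := by simp [psiQ, psi_ee, uu]
    have h2 := psiQ_equiv q t h0 ρ hρ x (ee 0 0 0 0)
    rw [h1, mul_one] at h2
    rw [h2]
    generalize ρ x (ee 0 0 0 0) = v
    induction v using Finsupp.induction_linear with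
    | zero => simp
    | add f g hf hg => rw [map_add]; exact add_mem hf hg
    | single p r =>
      obtain ⟨p, rfl⟩ := idx_surj p
      have h3 : psiQ q t (Finsupp.single (idx p) r) =
          (r * ((t ^ (p.1.2.1 + p.1.2.2.1)) ^ p.1.1)⁻¹) • Amono q t p := by
        rw [hm, smul_smul, inv_mul_cancel_right₀ (hk p), ← map_smul]; simp
      rw [h3]
      exact Submodule.smul_mem _ _ (Submodule.subset_span ⟨p, rfl⟩)

end
end

section
/- Fix q ∈ ℂ with q ≠ 0 and q not a root of unity, and fix t ∈ ℂ with t² = −q. Let 𝒰 be the quotient of the free ℂ-algebra on four generators e, f, k, k' by the two-sided ideal generated by kk' − 1, k'k − 1, kek' − qe, kfk' − q⁻¹f, and ef + fe − (k − k')/(q − q⁻¹), and let Γ = ef + (kt⁻¹ + k⁻¹t)/((q − q⁻¹)(t − t⁻¹)) ∈ 𝒰, where k⁻¹ denotes the image of k'. Then Γk = kΓ, Γk⁻¹ = k⁻¹Γ, Γe + eΓ = 0, and Γf + fΓ = 0. -/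
noncomputable section

/-- Generators of the free algebra on `e, f, k, k'` (indexed `0, 1, 2, 3`). -/
def Ugen (i : Fin 4) : FreeAlgebra ℂ (Fin 4) := FreeAlgebra.ι ℂ i

/-- The defining relations (2.1) of `U_q(osp(1,2))`: each constructor `u ~ v`
corresponds to the generator `u − v` of the two-sided ideal. -/
inductive URel (q : ℂ) : FreeAlgebra ℂ (Fin 4) → FreeAlgebra ℂ (Fin 4) → Prop
  | kk' : URel q (Ugen 2 * Ugen 3) 1
  | k'k : URel q (Ugen 3 * Ugen 2) 1
  | kek' : URel q (Ugen 2 * Ugen 0 * Ugen 3) (q • Ugen 0)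
  | kfk' : URel q (Ugen 2 * Ugen 1 * Ugen 3) (q⁻¹ • Ugen 1)
  | ef : URel q (Ugen 0 * Ugen 1 + Ugen 1 * Ugen 0) ((q - q⁻¹)⁻¹ • (Ugen 2 - Ugen 3))

/-- The quantized enveloping algebra `𝒰 = U_q(osp(1,2))`, the quotient of the
free algebra by the two-sided ideal generated by the relations. -/
abbrev QuantumU (q : ℂ) := RingQuot (URel q)

/-- Images of the generators `e, f, k, k'` in `𝒰`. -/
def ugen (q : ℂ) (i : Fin 4) : QuantumU q :=
  RingQuot.mkAlgHom ℂ (URel q) (Ugen i)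

/-- `k^m` for `m : ℤ`, meaning `(k')^{−m}` when `m < 0`. -/
def kpow (q : ℂ) (m : ℤ) : QuantumU q :=
  if 0 ≤ m then ugen q 2 ^ m.toNat else ugen q 3 ^ (-m).toNat

/-- The element `Γ = ef + (k t⁻¹ + k⁻¹ t)/((q − q⁻¹)(t − t⁻¹))` of (4.10). -/
def Gamma (q t : ℂ) : QuantumU q :=
  ugen q 0 * ugen q 1 +
    ((q - q⁻¹) * (t - t⁻¹))⁻¹ • (t⁻¹ • ugen q 2 + t • ugen q 3)

theorem gamma_aux {A : Type*} [Ring A] [Algebra ℂ A] (q t : ℂ) (hq0 : q ≠ 0)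
    (hq : ∀ n : ℕ, 0 < n → q ^ n ≠ 1) (ht : t ^ 2 = -q) (e f k l : A)
    (h1 : k * l = 1) (h2 : l * k = 1) (h3 : k * e * l = q • e) (h4 : k * f * l = q⁻¹ • f)
    (h5 : e * f + f * e = (q - q⁻¹)⁻¹ • (k - l)) (G : A)
    (hG : G = e * f + ((q - q⁻¹) * (t - t⁻¹))⁻¹ • (t⁻¹ • k + t • l)) :
    G * k = k * G ∧ G * l = l * G ∧ G * e + e * G = 0 ∧ G * f + f * G = 0 := by
  have ke : k * e = q • (e * k) := by
    have := congrArg (· * k) h3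
    simpa [mul_assoc, h2] using this
  have fk : f * k = q • (k * f) := by
    have := congrArg (fun x => q • (x * k)) h4
    simp only [mul_assoc, h2, mul_one, smul_mul_assoc, smul_smul, mul_inv_cancel₀ hq0,
      one_smul] at this
    exact this.symm
  have el : e * l = q • (l * e) := by
    have := congrArg (l * ·) h3
    simpa [← mul_assoc, h2] using this
  have lf : l * f = q • (f * l) := by
    have := congrArg (fun x => q • (l * x)) h4
    simp only [← mul_assoc, h2, one_mul, mul_smul_comm, smul_smul, mul_inv_cancel₀ hq0,
      one_smul] at this
    exact this.symm
  have ht0 : t ≠ 0 := by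
    rintro rfl
    apply hq0
    linear_combination ht
  have hq2 : q ^ 2 - 1 ≠ 0 := sub_ne_zero.mpr (hq 2 (by norm_num))
  have ht2 : t ^ 2 - 1 ≠ 0 := by
    intro h
    apply hq2
    linear_combination (q - 1) * (ht - h)
  have hqq : q = -t ^ 2 := by rw [ht]; ring
  have hc : q - q⁻¹ ≠ 0 := by
    intro h
    apply hq2
    field_simp at h
    linear_combination h
  have hd : t - t⁻¹ ≠ 0 := by
    intro h
    apply ht2
    field_simp at h
    linear_combination h
  set c := (q - q⁻¹)⁻¹ with hcdef
  have hdc : ((q - q⁻¹) * (t - t⁻¹))⁻¹ = c * (t - t⁻¹)⁻¹ := by rw [mul_inv]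
  have c1 : c + ((q - q⁻¹) * (t - t⁻¹))⁻¹ * t⁻¹ * (1 + q) = 0 := by
    rw [hdc]
    have : (t - t⁻¹) + t⁻¹ * (1 + q) = 0 := by
      field_simp
      linear_combination ht
    linear_combination c * (t - t⁻¹)⁻¹ * this - c * inv_mul_cancel₀ hd
  have c2 : -(c * q) + ((q - q⁻¹) * (t - t⁻¹))⁻¹ * t * (1 + q) = 0 := by
    rw [hdc]
    have : -((t - t⁻¹) * q) + t * (1 + q) = 0 := by
      field_simp
      linear_combination ht
    linear_combination c * (t - t⁻¹)⁻¹ * this + c * q * inv_mul_cancel₀ hd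
  set d := ((q - q⁻¹) * (t - t⁻¹))⁻¹ with hddef
  have Gk : G * k = k * G := by
    have : e * f * k = k * (e * f) := by
      rw [mul_assoc, fk, ← mul_assoc k, ke, mul_smul_comm, smul_mul_assoc, mul_assoc]
    rw [hG, add_mul, mul_add, this]
    simp [add_mul, mul_add, h1, h2]
  have Gl : G * l = l * G := by
    calc G * l = l * k * G * l := by rw [h2, one_mul]
      _ = l * (G * k) * l := by rw [Gk, mul_assoc l k G]
      _ = l * G := by rw [mul_assoc, mul_assoc G, h1, mul_one]
  refine ⟨Gk, Gl, ?_, ?_⟩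
  · have h := congrArg (e * ·) h5
    simp only [mul_add, mul_sub, mul_smul_comm, el] at h
    have : G * e + e * G = (e * (e * f) + e * (f * e)) + d • (t⁻¹ • (k * e + e * k) + t • (l * e + e * l)) := by
      rw [hG]
      simp only [add_mul, mul_add, smul_mul_assoc, mul_smul_comm, mul_assoc, smul_add]
      abel
    rw [this, h, ke, el]
    have : c • (e * k - q • (l * e)) + d • (t⁻¹ • (q • (e * k) + e * k) + t • (l * e + q • (l * e)))
      = (c + d * t⁻¹ * (1 + q)) • (e * k) + (-(c * q) + d * t * (1 + q)) • (l * e) := by module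
    rw [this, c1, c2]; simp
  · have h := congrArg (· * f) h5
    simp only [add_mul, sub_mul, smul_mul_assoc, lf] at h
    have : G * f + f * G = (e * f * f + f * e * f) + d • (t⁻¹ • (k * f + f * k) + t • (l * f + f * l)) := by
      rw [hG]
      simp only [add_mul, mul_add, smul_mul_assoc, mul_smul_comm, mul_assoc, smul_add]
      abel
    rw [this, h, fk, lf]
    have : c • (k * f - q • (f * l)) + d • (t⁻¹ • (k * f + q • (k * f)) + t • (q • (f * l) + f * l))
      = (c + d * t⁻¹ * (1 + q)) • (k * f) + (-(c * q) + d * t * (1 + q)) • (f * l) := by module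
    rw [this, c1, c2]; simp

/-- `Γ` lies in the super center of `𝒰`: it commutes with `k`
and `k⁻¹` and anticommutes with `e` and `f`. -/
theorem gamma_super_central (q t : ℂ) (hq0 : q ≠ 0)
    (hq : ∀ n : ℕ, 0 < n → q ^ n ≠ 1) (ht : t ^ 2 = -q) :
    Gamma q t * ugen q 2 = ugen q 2 * Gamma q t ∧
      Gamma q t * ugen q 3 = ugen q 3 * Gamma q t ∧
      Gamma q t * ugen q 0 + ugen q 0 * Gamma q t = 0 ∧
      Gamma q t * ugen q 1 + ugen q 1 * Gamma q t = 0 := by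
  have R : ∀ {x y}, URel q x y → RingQuot.mkAlgHom ℂ (URel q) x = RingQuot.mkAlgHom ℂ (URel q) y :=
    fun h => RingQuot.mkAlgHom_rel ℂ h
  refine gamma_aux q t hq0 hq ht (ugen q 0) (ugen q 1) (ugen q 2) (ugen q 3)
    ?_ ?_ ?_ ?_ ?_ _ rfl
  · simpa only [ugen, map_mul, map_one] using R URel.kk'
  · simpa only [ugen, map_mul, map_one] using R URel.k'k
  · simpa only [ugen, map_mul, map_smul] using R URel.kek'
  · simpa only [ugen, map_mul, map_smul] using R URel.kfk'
  · simpa only [ugen, map_mul, map_smul, map_add, map_sub] using R URel.ef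

end
end

section
/- Fix q ∈ ℂ with q ≠ 0 and q not a root of unity, and fix t ∈ ℂ with t² = −q. Let 𝒰 be the quotient of the free ℂ-algebra on four generators e, f, k, k' by the two-sided ideal generated by kk' − 1, k'k − 1, kek' − qe, kfk' − q⁻¹f, and ef + fe − (k − k')/(q − q⁻¹), and let Γ = ef + (kt⁻¹ + k⁻¹t)/((q − q⁻¹)(t − t⁻¹)) ∈ 𝒰, where k⁻¹ denotes the image of k'. Set x_{αβ} = (q − q⁻¹)e + fk and x_{β'γ'} = (t − t⁻¹)fk + (k − 1). Then for every m ∈ ℤ there exist u₁, u₂ ∈ 𝒰 such that k^m Γ − ((−q^{2m−1} + 1 + q⁻¹)/((q − q⁻¹)(t − t⁻¹)²))(k^{m+1} − k^m) + ((q^{2m−2} + 1 + q)/((q − q⁻¹)(t − t⁻¹)²))(k^{m−1} − k^m) − ((t + t⁻¹)/((q − q⁻¹)(t − t⁻¹))) k^m = u₁ x_{β'γ'} + x_{αβ} u₂. -/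
noncomputable section

theorem aux_abs {A : Type*} [Ring A] [Algebra ℂ A] (q t z : ℂ) (e f k k' P : A)
    (ht0 : t ≠ 0) (hs : t ^ 2 - 1 ≠ 0) (hp : t ^ 2 + 1 ≠ 0) (hqt : q = -t ^ 2)
    (hkk' : k * k' = 1) (hk'k : k' * k = 1) (hfk : f * k = q • (k * f))
    (hPe : P * e = z • (e * P)) (hfP : f * P = z • (P * f)) (hkP : k * P = P * k) :
    P * (e * f + ((q - q⁻¹) * (t - t⁻¹))⁻¹ • (t⁻¹ • k + t • k')) -
        ((-(z ^ 2 * q⁻¹) + 1 + q⁻¹) / ((q - q⁻¹) * (t - t⁻¹) ^ 2)) • (P * k - P) +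
        ((z ^ 2 * (q⁻¹) ^ 2 + 1 + q) / ((q - q⁻¹) * (t - t⁻¹) ^ 2)) • (P * k' - P) -
        ((t + t⁻¹) / ((q - q⁻¹) * (t - t⁻¹))) • P =
      ((-(q - q⁻¹)⁻¹ * z ^ 2 * q) • (((t - t⁻¹) * q)⁻¹ • (q⁻¹ • (P * f)) -
        (((t - t⁻¹) * q)⁻¹ ^ 2) • (P - q⁻¹ • (P * k')))) *
          ((t - t⁻¹) • (f * k) + (k - 1)) +
        ((q - q⁻¹) • e + f * k) * ((z * (q - q⁻¹)⁻¹) • (P * f)) := by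
  have a1 : ∀ x, k' * (k * x) = x := fun x => by rw [← mul_assoc, hk'k, one_mul]
  have a3 : ∀ x, f * (k * x) = q • (k * (f * x)) := fun x => by
    rw [← mul_assoc, hfk, smul_mul_assoc, mul_assoc]
  have a4 : ∀ x, P * (e * x) = z • (e * (P * x)) := fun x => by
    rw [← mul_assoc, hPe, smul_mul_assoc, mul_assoc]
  have a5 : ∀ x, f * (P * x) = z • (P * (f * x)) := fun x => by
    rw [← mul_assoc, hfP, smul_mul_assoc, mul_assoc]
  have a6 : ∀ x, k * (P * x) = P * (k * x) := fun x => by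
    rw [← mul_assoc, hkP, mul_assoc]
  have h4 : -t ^ 2 - (-t ^ 2)⁻¹ = -((t ^ 2 - 1) * (t ^ 2 + 1) / t ^ 2) := by
    field_simp; ring
  have h5 : t - t⁻¹ = (t ^ 2 - 1) / t := by field_simp
  rw [← hqt] at h4
  rw [h4, h5]
  generalize hL : -((t ^ 2 - 1) * (t ^ 2 + 1) / t ^ 2) = L
  generalize hS : (t ^ 2 - 1) / t = S
  simp only [mul_add, add_mul, mul_sub, sub_mul, smul_mul_assoc, mul_smul_comm, mul_assoc,
    mul_one, hk'k, a1, hfk, a3, a4, a5, a6]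
  subst hqt
  have g1 : 1 - t ^ 2 ≠ 0 := fun h => hs (by linear_combination -h)
  have g2 : -1 + t ^ 2 ≠ 0 := fun h => hs (by linear_combination h)
  have g3 : t ^ 2 + -1 ≠ 0 := fun h => hs (by linear_combination h)
  have g4 : -t ^ 2 + 1 ≠ 0 := fun h => hs (by linear_combination -h)
  have g5 : 1 + t ^ 2 ≠ 0 := fun h => hp (by linear_combination h)
  match_scalars <;> simp only [← hL, ← hS] <;> field_simp <;> ring

section
variable (q : ℂ)

theorem u_kk' : ugen q 2 * ugen q 3 = 1 := by
  have := RingQuot.mkAlgHom_rel ℂ (URel.kk' (q := q))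
  simpa [ugen] using this

theorem u_k'k : ugen q 3 * ugen q 2 = 1 := by
  have := RingQuot.mkAlgHom_rel ℂ (URel.k'k (q := q))
  simpa [ugen] using this

theorem u_ke : ugen q 2 * ugen q 0 = q • (ugen q 0 * ugen q 2) := by
  have := RingQuot.mkAlgHom_rel ℂ (URel.kek' (q := q))
  simp only [map_mul, map_smul] at this
  change ugen q 2 * ugen q 0 * ugen q 3 = q • ugen q 0 at this
  rw [← smul_mul_assoc, ← this, mul_assoc _ (ugen q 3), u_k'k, mul_one]

theorem u_kf : ugen q 2 * ugen q 1 = q⁻¹ • (ugen q 1 * ugen q 2) := by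
  have := RingQuot.mkAlgHom_rel ℂ (URel.kfk' (q := q))
  simp only [map_mul, map_smul] at this
  change ugen q 2 * ugen q 1 * ugen q 3 = q⁻¹ • ugen q 1 at this
  rw [← smul_mul_assoc, ← this, mul_assoc _ (ugen q 3), u_k'k, mul_one]

/-- `k` as a unit. -/
def kU : (QuantumU q)ˣ := ⟨ugen q 2, ugen q 3, u_kk' q, u_k'k q⟩

theorem kpow_eq (m : ℤ) : kpow q m = ((kU q ^ m : (QuantumU q)ˣ) : QuantumU q) := by
  unfold kpow
  split_ifs with h
  · obtain ⟨n, rfl⟩ := Int.eq_ofNat_of_zero_le h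
    simp [kU]
  · obtain ⟨n, hn⟩ := Int.eq_ofNat_of_zero_le (show 0 ≤ -m by omega)
    obtain rfl : m = -(n : ℤ) := by omega
    simp only [neg_neg, Int.toNat_natCast, zpow_neg, zpow_natCast, ← inv_pow, Units.val_pow_eq_pow_val]
    rfl

theorem kpow_succ (m : ℤ) : kpow q (m + 1) = kpow q m * ugen q 2 := by
  rw [kpow_eq, kpow_eq, zpow_add_one]; rfl

theorem kpow_pred (m : ℤ) : kpow q (m - 1) = kpow q m * ugen q 3 := by
  rw [kpow_eq, kpow_eq, zpow_sub_one]; rfl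

theorem k_kpow (m : ℤ) : ugen q 2 * kpow q m = kpow q m * ugen q 2 := by
  rw [← kpow_succ, kpow_eq, kpow_eq, add_comm, zpow_one_add]; rfl

theorem kpow_comm (c : ℂ) (hc : c ≠ 0) (x : QuantumU q)
    (h : ugen q 2 * x = c • (x * ugen q 2)) (m : ℤ) :
    kpow q m * x = c ^ m • (x * kpow q m) := by
  have h' : ugen q 3 * x = c⁻¹ • (x * ugen q 3) := by
    have := congrArg (fun y => c⁻¹ • (ugen q 3 * y * ugen q 3)) h
    simp only [mul_smul_comm, smul_mul_assoc, smul_smul, inv_mul_cancel₀ hc, one_smul] at this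
    rw [← mul_assoc, u_k'k, one_mul, mul_assoc (ugen q 3), mul_assoc x, u_kk', mul_one] at this
    exact this.symm
  induction m using Int.induction_on with
  | zero => simp [kpow]
  | succ n ih =>
    rw [kpow_succ, mul_assoc, h, mul_smul_comm, ← mul_assoc, ih, smul_mul_assoc, smul_smul,
      zpow_add_one₀ hc, mul_comm c, mul_assoc]
  | pred n ih =>
    rw [kpow_pred, mul_assoc, h', mul_smul_comm, ← mul_assoc, ih, smul_mul_assoc, smul_smul,
      zpow_sub_one₀ hc, mul_comm c⁻¹, mul_assoc]

end

/-- relation (4.21): with `x_{αβ} = (q − q⁻¹)e + fk` and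
`x_{β'γ'} = (t − t⁻¹)fk + (k − 1)`, for every `m ∈ ℤ`,
`k^m Γ − ((−q^{2m−1} + 1 + q⁻¹)/((q − q⁻¹)(t − t⁻¹)²))(k^{m+1} − k^m)
 + ((q^{2m−2} + 1 + q)/((q − q⁻¹)(t − t⁻¹)²))(k^{m−1} − k^m)
 − ((t + t⁻¹)/((q − q⁻¹)(t − t⁻¹))) k^m`
lies in `𝒰 x_{β'γ'} + x_{αβ} 𝒰`. -/
theorem relation_4_21 (q t : ℂ) (hq0 : q ≠ 0)
    (hq : ∀ n : ℕ, 0 < n → q ^ n ≠ 1) (ht : t ^ 2 = -q) (m : ℤ) :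
    ∃ u₁ u₂ : QuantumU q,
      kpow q m * Gamma q t -
        ((-q ^ (2 * m - 1) + 1 + q⁻¹) / ((q - q⁻¹) * (t - t⁻¹) ^ 2)) •
          (kpow q (m + 1) - kpow q m) +
        ((q ^ (2 * m - 2) + 1 + q) / ((q - q⁻¹) * (t - t⁻¹) ^ 2)) •
          (kpow q (m - 1) - kpow q m) -
        ((t + t⁻¹) / ((q - q⁻¹) * (t - t⁻¹))) • kpow q m =
      u₁ * ((t - t⁻¹) • (ugen q 1 * ugen q 2) + (ugen q 2 - 1)) +
        ((q - q⁻¹) • ugen q 0 + ugen q 1 * ugen q 2) * u₂ := by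
  have hqt : q = -t ^ 2 := by rw [ht, neg_neg]
  have ht0 : t ≠ 0 := by
    rintro rfl
    apply hq0
    rw [hqt]; simp
  have hs : t ^ 2 - 1 ≠ 0 := by
    intro h
    apply hq 2 (by norm_num)
    rw [hqt]; linear_combination (t ^ 2 + 1) * h
  have hp : t ^ 2 + 1 ≠ 0 := by
    intro h
    apply hq 1 (by norm_num)
    rw [hqt]; linear_combination -h
  have hzz : (q⁻¹ ^ m) = (q ^ m)⁻¹ := inv_zpow q m
  have hz : q ^ m ≠ 0 := zpow_ne_zero m hq0
  have hfk : ugen q 1 * ugen q 2 = q • (ugen q 2 * ugen q 1) := by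
    rw [u_kf, smul_smul, mul_inv_cancel₀ hq0, one_smul]
  have hfP : ugen q 1 * kpow q m = q ^ m • (kpow q m * ugen q 1) := by
    rw [kpow_comm q q⁻¹ (inv_ne_zero hq0) _ (u_kf q) m, hzz, smul_smul, mul_inv_cancel₀ hz,
      one_smul]
  have e1 : q ^ (2 * m - 1) = (q ^ m) ^ 2 * q⁻¹ := by
    rw [zpow_sub_one₀ hq0, mul_comm 2 m, zpow_mul]; rfl
  have e2 : q ^ (2 * m - 2) = (q ^ m) ^ 2 * q⁻¹ ^ 2 := by
    rw [zpow_sub₀ hq0, mul_comm 2 m, zpow_mul, inv_pow, div_eq_mul_inv]; rfl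
  rw [e1, e2, kpow_succ, kpow_pred]
  exact ⟨_, _, aux_abs q t (q ^ m) _ _ _ _ _ ht0 hs hp hqt (u_kk' q) (u_k'k q) hfk
    (kpow_comm q q hq0 _ (u_ke q) m) hfP (k_kpow q m)⟩
end
end
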